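/- Theorem 3.1(iv): Let ρ ∈ W^{1,1}(H), i.e. ρ ∈ L¹(H,μ) and there exist ρ_n ∈ C_b¹(H) with ρ_n → ρ in L¹(H,μ) such that (Dρ_n) converges in L¹(H,μ;H) to some Φ =: Dρ. Assume moreover ∫_H A_{1/2}(|ρ|) dμ < ∞. Then ρ ∈ BV(H,H) (i.e. with weights c_j ≡ 1) with V(ρ) = ∫_H |Dρ(z)| μ(dz), and for every G ∈ (C_b¹)_{D(A)}: ∫_H D*G(z) ρ(z) μ(dz) = ∫_H ⟨G(z), σ(z)⟩ |Dρ(z)| μ(dz), where σ(z) := Dρ(z)/|Dρ(z)| if Dρ(z) ≠ 0 and σ(z) := 0 otherwise. -/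

import Mathlib

open MeasureTheory Filter
open scoped RealInnerProductSpace ENNReal NNReal BigOperators

noncomputable section

variable {H : Type*} [NormedAddCommGroup H] [InnerProductSpace ℝ H]

/-- `v ∈ C_b¹(H)` with gradient `Dv`: `v` is bounded, everywhere Fréchet differentiable with
derivative represented by the gradient `Dv`, and `Dv` is continuous and bounded. -/
def IsCb1 (v : H → ℝ) (Dv : H → H) : Prop :=
  (∀ x : H, HasFDerivAt v (innerSL ℝ (Dv x)) x) ∧ Continuous Dv ∧
    (∃ C, ∀ x, |v x| ≤ C) ∧ ∃ C, ∀ x, ‖Dv x‖ ≤ C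

/-- The operator `A` determined by `A e_j = α_j e_j`. -/
def Aop (e : ℕ → H) (α : ℕ → ℝ) (x : H) : H := ∑' j, (α j * ⟪x, e j⟫) • e j

/-- Membership in the domain `D(A)`. -/
def memDA (e : ℕ → H) (α : ℕ → ℝ) (x : H) : Prop :=
  Summable fun j => α j ^ 2 * ⟪x, e j⟫ ^ 2

/-- The covariance operator `Q = (1/2) A⁻¹`, i.e. `Q e_j = (2 α_j)⁻¹ e_j`. -/
def Qop (e : ℕ → H) (α : ℕ → ℝ) (x : H) : H := ∑' j, ((2 * α j)⁻¹ * ⟪x, e j⟫) • e j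

/-- `Q^{1/2}`, i.e. `Q^{1/2} e_j = (2 α_j)^{-1/2} e_j`. -/
def Qhalf (e : ℕ → H) (α : ℕ → ℝ) (x : H) : H :=
  ∑' j, ((Real.sqrt (2 * α j))⁻¹ * ⟪x, e j⟫) • e j

/-- `D*G` for `G(z) = ∑_{i} g_i(z) l^i` (`Dg i` being the gradient of `g i`):
`D*G(z) = ∑ i (−⟨l^i, Dg_i(z)⟩ + 2 g_i(z) ⟨A l^i, z⟩)`. -/
def Dstar (e : ℕ → H) (α : ℕ → ℝ) {m : ℕ} (g : Fin m → H → ℝ) (Dg : Fin m → H → H)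
    (l : Fin m → H) (z : H) : ℝ :=
  ∑ i, (-⟪l i, Dg i z⟫ + 2 * g i z * ⟪Aop e α (l i), z⟫)

/-- Membership in `H₁ = {x : ∑_j c_j² ⟨x,e_j⟩² < ∞}`. -/
def memH1 (c : ℕ → ℝ) (e : ℕ → H) (x : H) : Prop :=
  Summable fun j => c j ^ 2 * ⟪x, e j⟫ ^ 2

/-- The squared `H₁`-norm `∑_j c_j² ⟨x,e_j⟩²`. -/
def normH1sq (c : ℕ → ℝ) (e : ℕ → H) (x : H) : ℝ := ∑' j, c j ^ 2 * ⟪x, e j⟫ ^ 2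

/-- The `H₁`-inner product `∑_j c_j² ⟨x,e_j⟩⟨y,e_j⟩`. -/
def innerH1 (c : ℕ → ℝ) (e : ℕ → H) (x y : H) : ℝ :=
  ∑' j, c j ^ 2 * (⟪x, e j⟫ * ⟪y, e j⟫)

/-- `A_{1/2}(x) = ∫₀ˣ (log(1+s))^{1/2} ds`. -/
def A12 (x : ℝ) : ℝ := ∫ s in (0:ℝ)..x, Real.sqrt (Real.log (1 + s))

/-- `ψ(y) = ∫₀ʸ (exp(t²) − 1) dt`. -/
def psiOrlicz (y : ℝ) : ℝ := ∫ t in (0:ℝ)..y, (Real.exp (t ^ 2) - 1)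

variable [MeasurableSpace H]

/-- The set whose infimum is the Luxemburg norm of `f` for the Young function `Φ`. -/
def LuxSet (Φ : ℝ → ℝ) (μ : Measure H) (f : H → ℝ) : Set ℝ :=
  {a | 0 < a ∧ ∫ x, Φ (|f x| / a) ∂μ ≤ 1}

/-- The Luxemburg norm. -/
def LuxNorm (Φ : ℝ → ℝ) (μ : Measure H) (f : H → ℝ) : ℝ := sInf (LuxSet Φ μ f)

/-- The set of numbers `∫_H D*G ρ dμ`, where `G` ranges over all
`G ∈ (C_b¹)_{D(A)∩H₁}` with `‖G(z)‖_{H₁} ≤ 1` for all `z`; its supremum is `V(ρ)`. -/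
def BVset (c : ℕ → ℝ) (e : ℕ → H) (α : ℕ → ℝ) (μ : Measure H) (ρ : H → ℝ) : Set ℝ :=
  {r | ∃ (m : ℕ) (g : Fin m → H → ℝ) (Dg : Fin m → H → H) (l : Fin m → H),
    (∀ i, IsCb1 (g i) (Dg i)) ∧ (∀ i, memDA e α (l i)) ∧ (∀ i, memH1 c e (l i)) ∧
    (∀ z, memH1 c e (∑ i, g i z • l i) ∧ normH1sq c e (∑ i, g i z • l i) ≤ 1) ∧
    r = ∫ z, Dstar e α g Dg l z * ρ z ∂μ}

/-- The analogous set for `H₁ = H` (weights `c_j ≡ 1`), where the constraint is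
`|G(z)| ≤ 1` in `H`; its supremum is `V(ρ)` for `BV(H,H)`. -/
def BVsetH (e : ℕ → H) (α : ℕ → ℝ) (μ : Measure H) (ρ : H → ℝ) : Set ℝ :=
  {r | ∃ (m : ℕ) (g : Fin m → H → ℝ) (Dg : Fin m → H → H) (l : Fin m → H),
    (∀ i, IsCb1 (g i) (Dg i)) ∧ (∀ i, memDA e α (l i)) ∧
    (∀ z, ‖∑ i, g i z • l i‖ ≤ 1) ∧
    r = ∫ z, Dstar e α g Dg l z * ρ z ∂μ}

section Gaussian

/-- Gaussian integration by parts on the real line. -/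
lemma gaussianReal_integral_mul_deriv {v : ℝ≥0} {φ φ' : ℝ → ℝ}
    (hφ : ∀ x, HasDerivAt φ (φ' x) x) (hφ' : Continuous φ')
    {C C' : ℝ} (hC : ∀ x, |φ x| ≤ C) (hC' : ∀ x, |φ' x| ≤ C') :
    v * ∫ x, φ' x ∂(ProbabilityTheory.gaussianReal 0 v)
      = ∫ x, x * φ x ∂(ProbabilityTheory.gaussianReal 0 v) := by
  by_cases hv : v = 0
  · subst hv
    simp [ProbabilityTheory.gaussianReal_zero_var]
  have hv' : (v : ℝ) ≠ 0 := by exact_mod_cast hv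
  rw [ProbabilityTheory.integral_gaussianReal_eq_integral_smul hv,
    ProbabilityTheory.integral_gaussianReal_eq_integral_smul hv]
  have hφc : Continuous φ := continuous_iff_continuousAt.2 fun x => (hφ x).continuousAt
  set p := ProbabilityTheory.gaussianPDFReal 0 v with hp
  have hpd : ∀ x, HasDerivAt p (-(x / v) * p x) x := by
    intro x
    have h1 : HasDerivAt (fun y : ℝ => -(y - 0) ^ 2 / (2 * v)) (-(x / v)) x := by
      have := (((hasDerivAt_id x).sub_const 0).pow 2).neg.div_const (2 * (v : ℝ))
      refine this.congr_deriv ?_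
      simp
      field_simp
    have := h1.exp.const_mul ((Real.sqrt (2 * Real.pi * v))⁻¹)
    refine this.congr_deriv ?_
    simp only [hp, ProbabilityTheory.gaussianPDFReal]
    ring
  have hpi : Integrable p := ProbabilityTheory.integrable_gaussianPDFReal 0 v
  have hxp : Integrable (fun x => x * p x) := by
    have h := (integrable_mul_exp_neg_mul_sq (b := (2 * (v : ℝ))⁻¹) (by positivity)).const_mul
      ((Real.sqrt (2 * Real.pi * v))⁻¹)
    refine h.congr (Eventually.of_forall fun x => ?_)
    simp only [hp, ProbabilityTheory.gaussianPDFReal]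
    have : -(x - 0) ^ 2 / (2 * (v : ℝ)) = -(2 * (v : ℝ))⁻¹ * x ^ 2 := by
      rw [sub_zero]; field_simp
    rw [this]; ring
  have key := integral_mul_deriv_eq_deriv_mul_of_integrable (u := φ) (v := p) (u' := φ')
    (v' := fun x => -(x / v) * p x) (fun x _ => hφ x) (fun x _ => hpd x)
    ?_ ?_ ?_
  · have e1 : ∫ x, p x • φ' x = - ∫ x, φ x * (-(x / v) * p x) := by
      rw [key, neg_neg]
      exact integral_congr_ae (Eventually.of_forall fun x => by simp [mul_comm])
    rw [e1, ← integral_neg, ← integral_const_mul]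
    refine integral_congr_ae (Eventually.of_forall fun x => ?_)
    simp only [smul_eq_mul]
    field_simp
  · refine ((hxp.const_mul (-(v : ℝ)⁻¹)).bdd_mul (c := C) hφc.aestronglyMeasurable
      (Eventually.of_forall hC)).congr (Eventually.of_forall fun x => ?_)
    simp only [Pi.mul_apply]
    field_simp
  · exact hpi.bdd_mul (c := C') hφ'.aestronglyMeasurable (Eventually.of_forall hC')
  · exact hpi.bdd_mul (c := C) hφc.aestronglyMeasurable (Eventually.of_forall hC)

variable {E : Type*} [NormedAddCommGroup E] [InnerProductSpace ℝ E] [CompleteSpace E]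
  [SecondCountableTopology E] [MeasurableSpace E] [BorelSpace E]

/-- A measure with Gaussian characteristic function is invariant under resampling its component
in a Cameron–Martin direction `h`, where `k` is the preimage of `h` under the covariance. -/
lemma map_prod_gaussianReal_resample {μ : Measure E} [IsProbabilityMeasure μ] {q : E → ℝ}
    (hchar : ∀ w, charFun μ w = Complex.exp (-(q w : ℂ) / 2)) {h k : E} {s : ℝ≥0} (hs : s ≠ 0)
    (hq : ∀ w c, q (w - c • k) = q w - 2 * c * ⟪h, w⟫ + c ^ 2 * s) :
    ((ProbabilityTheory.gaussianReal 0 s).prod μ).map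
      (fun p : ℝ × E => p.2 - (⟪p.2, k⟫ / s) • h + (p.1 / s) • h) = μ := by
  have hs' : (s : ℝ) ≠ 0 := by exact_mod_cast hs
  have hmeas : Measurable (fun p : ℝ × E => p.2 - (⟪p.2, k⟫ / s) • h + (p.1 / s) • h) := by
    have : Continuous (fun p : ℝ × E => p.2 - (⟪p.2, k⟫ / s) • h + (p.1 / s) • h) := by fun_prop
    exact this.measurable
  have : IsProbabilityMeasure (((ProbabilityTheory.gaussianReal 0 s).prod μ).map
      (fun p : ℝ × E => p.2 - (⟪p.2, k⟫ / s) • h + (p.1 / s) • h)) :=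
    Measure.isProbabilityMeasure_map hmeas.aemeasurable
  refine Measure.ext_of_charFun ?_
  ext w
  rw [charFun_apply, integral_map hmeas.aemeasurable (by fun_prop)]
  have e1 : ∀ p : ℝ × E,
      Complex.exp ((⟪p.2 - (⟪p.2, k⟫ / s) • h + (p.1 / s) • h, w⟫ : ℝ) * Complex.I)
      = Complex.exp (((⟪h, w⟫ / s : ℝ) : ℂ) * p.1 * Complex.I)
        * Complex.exp ((⟪p.2, w - (⟪h, w⟫ / s) • k⟫ : ℝ) * Complex.I) := by
    intro p
    rw [← Complex.exp_add]
    congr 1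
    rw [inner_add_left, inner_sub_left, inner_smul_left, inner_smul_left, inner_sub_right,
      inner_smul_right]
    simp only [conj_trivial]
    push_cast
    ring
  simp_rw [e1]
  rw [integral_prod_mul (fun x : ℝ => Complex.exp (((⟪h, w⟫ / s : ℝ) : ℂ) * x * Complex.I))
    (fun z : E => Complex.exp ((⟪z, w - (⟪h, w⟫ / s) • k⟫ : ℝ) * Complex.I)),
    ← charFun_apply_real, ← charFun_apply, ProbabilityTheory.charFun_gaussianReal, hchar, hchar,
    ← Complex.exp_add, hq]
  congr 1
  have hs'' : ((s : ℝ) : ℂ) ≠ 0 := by exact_mod_cast hs'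
  push_cast
  field_simp
  ring

/-- Gaussian integration by parts in a Cameron–Martin direction. -/
lemma integral_inner_gradient_eq {μ : Measure E} [IsProbabilityMeasure μ] {q : E → ℝ}
    (hchar : ∀ w, charFun μ w = Complex.exp (-(q w : ℂ) / 2)) {h k : E} {s : ℝ≥0} (hs : s ≠ 0)
    (hq : ∀ w c, q (w - c • k) = q w - 2 * c * ⟪h, w⟫ + c ^ 2 * s) (hhk : ⟪h, k⟫ = s)
    (hX : Integrable (fun z => ⟪k, z⟫) μ)
    {u : E → ℝ} {Du : E → E} (hu : IsCb1 u Du) :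
    ∫ z, ⟪h, Du z⟫ ∂μ = ∫ z, ⟪k, z⟫ * u z ∂μ := by
  obtain ⟨hd, hDc, ⟨C, hC⟩, ⟨C', hC'⟩⟩ := hu
  have hs' : (s : ℝ) ≠ 0 := by exact_mod_cast hs
  have huc : Continuous u := continuous_iff_continuousAt.2 fun x => (hd x).continuousAt
  set T : ℝ × E → E := fun p => p.2 - (⟪p.2, k⟫ / s) • h + (p.1 / s) • h with hT
  have hTc : Continuous T := by rw [hT]; fun_prop
  have hμ := map_prod_gaussianReal_resample hchar hs hq
  have hi1 : Integrable (fun z => ⟪h, Du z⟫) μ := by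
    refine Integrable.of_bound (by fun_prop) (‖h‖ * C') (Eventually.of_forall fun z => ?_)
    exact (norm_inner_le_norm _ _).trans (by gcongr; exact hC' z)
  have hi2 : Integrable (fun z => ⟪k, z⟫ * u z) μ :=
    hX.mul_bdd (c := C) (by fun_prop) (Eventually.of_forall hC)
  have t1 : ∫ z, ⟪h, Du z⟫ ∂μ = ∫ z, ∫ x, ⟪h, Du (T (x, z))⟫
      ∂(ProbabilityTheory.gaussianReal 0 s) ∂μ := by
    rw [← hμ] at hi1
    conv_lhs => rw [← hμ]
    rw [integral_map hTc.aemeasurable (by fun_prop), integral_prod_symm]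
    exact hi1.comp_measurable hTc.measurable
  have t2 : ∫ z, ⟪k, z⟫ * u z ∂μ = ∫ z, ∫ x, ⟪k, T (x, z)⟫ * u (T (x, z))
      ∂(ProbabilityTheory.gaussianReal 0 s) ∂μ := by
    rw [← hμ] at hi2
    conv_lhs => rw [← hμ]
    rw [integral_map hTc.aemeasurable (by fun_prop), integral_prod_symm]
    exact hi2.comp_measurable hTc.measurable
  rw [t1, t2]
  refine integral_congr_ae (Eventually.of_forall fun z => ?_)
  have hder : ∀ x : ℝ, HasDerivAt (fun y => u (T (y, z))) ((s : ℝ)⁻¹ * ⟪h, Du (T (x, z))⟫) x := by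
    intro x
    have h1 : HasDerivAt (fun y : ℝ => T (y, z)) ((s : ℝ)⁻¹ • h) x := by
      have := (((hasDerivAt_id x).div_const (s : ℝ)).smul_const h).const_add
        (z - (⟪z, k⟫ / s) • h)
      simpa [hT] using this
    refine ((hd (T (x, z))).comp_hasDerivAt x h1).congr_deriv ?_
    simp [real_inner_comm]
  have key := gaussianReal_integral_mul_deriv (v := s) hder (by fun_prop) (C := C)
    (C' := (s : ℝ)⁻¹ * (‖h‖ * C')) (fun x => hC _) (fun x => by
      rw [abs_mul, abs_of_nonneg (by positivity)]
      gcongr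
      exact (abs_real_inner_le_norm _ _).trans (by gcongr; exact hC' _))
  rw [integral_const_mul, ← mul_assoc, mul_inv_cancel₀ hs', one_mul] at key
  simp only [key]
  refine integral_congr_ae (Eventually.of_forall fun x => ?_)
  have : ⟪k, T (x, z)⟫ = x := by
    simp only [hT, inner_add_right, inner_sub_right, inner_smul_right, real_inner_comm h k,
      real_inner_comm z k, hhk]
    field_simp
    ring
  simp only [this]

end Gaussian
section Cb1

variable {E : Type*} [NormedAddCommGroup E] [InnerProductSpace ℝ E]

namespace IsCb1

variable {u v : E → ℝ} {Du Dv : E → E}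

lemma continuous (hu : IsCb1 u Du) : Continuous u :=
  continuous_iff_continuousAt.2 fun x => (hu.1 x).continuousAt

lemma continuous_gradient (hu : IsCb1 u Du) : Continuous Du := hu.2.1

lemma exists_bound (hu : IsCb1 u Du) : ∃ C, ∀ x, |u x| ≤ C := hu.2.2.1

lemma exists_bound_gradient (hu : IsCb1 u Du) : ∃ C, ∀ x, ‖Du x‖ ≤ C := hu.2.2.2

lemma mul (hu : IsCb1 u Du) (hv : IsCb1 v Dv) :
    IsCb1 (fun z => u z * v z) (fun z => u z • Dv z + v z • Du z) := by
  have huc := hu.continuous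
  have hvc := hv.continuous
  obtain ⟨hu1, hu2, ⟨C, hC⟩, ⟨C', hC'⟩⟩ := hu
  obtain ⟨hv1, hv2, ⟨K, hK⟩, ⟨K', hK'⟩⟩ := hv
  have hC0 : ∀ x : E, 0 ≤ C := fun x => (abs_nonneg _).trans (hC x)
  have hK0 : ∀ x : E, 0 ≤ K := fun x => (abs_nonneg _).trans (hK x)
  refine ⟨fun x => ?_, by fun_prop, ⟨C * K, fun x => ?_⟩, ⟨C * K' + K * C', fun x => ?_⟩⟩
  · refine ((hu1 x).mul (hv1 x)).congr_fderiv ?_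
    simp
  · rw [abs_mul]
    exact mul_le_mul (hC x) (hK x) (abs_nonneg _) (hC0 x)
  · refine (norm_add_le _ _).trans ?_
    rw [norm_smul, norm_smul, Real.norm_eq_abs, Real.norm_eq_abs]
    exact add_le_add (mul_le_mul (hC x) (hK' x) (norm_nonneg _) (hC0 x))
      (mul_le_mul (hK x) (hC' x) (norm_nonneg _) (hK0 x))

lemma const_mul (c : ℝ) (hu : IsCb1 u Du) : IsCb1 (fun z => c * u z) (fun z => c • Du z) := by
  obtain ⟨hu1, hu2, ⟨C, hC⟩, ⟨C', hC'⟩⟩ := hu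
  refine ⟨fun x => ?_, by fun_prop, ⟨|c| * C, fun x => ?_⟩, ⟨|c| * C', fun x => ?_⟩⟩
  · refine ((hu1 x).const_mul c).congr_fderiv ?_
    simp
  · rw [abs_mul]
    gcongr
    exact hC x
  · rw [norm_smul, Real.norm_eq_abs]
    gcongr
    exact hC' x

lemma sum {ι : Type*} (s : Finset ι) {u : ι → E → ℝ} {Du : ι → E → E}
    (hu : ∀ i, IsCb1 (u i) (Du i)) :
    IsCb1 (fun z => ∑ i ∈ s, u i z) (fun z => ∑ i ∈ s, Du i z) := by
  choose C hC using fun i => (hu i).exists_bound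
  choose C' hC' using fun i => (hu i).exists_bound_gradient
  have hDc := fun i => (hu i).continuous_gradient
  refine ⟨fun x => ?_, by fun_prop, ⟨∑ i ∈ s, C i, fun x => ?_⟩, ⟨∑ i ∈ s, C' i, fun x => ?_⟩⟩
  · refine (HasFDerivAt.fun_sum fun i _ => (hu i).1 x).congr_fderiv ?_
    simp
  · exact (Finset.abs_sum_le_sum_abs _ _).trans (Finset.sum_le_sum fun i _ => hC i x)
  · exact (norm_sum_le _ _).trans (Finset.sum_le_sum fun i _ => hC' i x)

lemma comp {φ φ' : ℝ → ℝ} (hu : IsCb1 u Du) (hφ : ∀ x, HasDerivAt φ (φ' (u x)) (u x))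
    (hφ'c : Continuous fun x => φ' (u x)) {K K' : ℝ} (hK : ∀ x, |φ (u x)| ≤ K)
    (hK' : ∀ x, |φ' (u x)| ≤ K') :
    IsCb1 (fun z => φ (u z)) (fun z => φ' (u z) • Du z) := by
  obtain ⟨hu1, hu2, -, ⟨C', hC'⟩⟩ := hu
  refine ⟨fun x => ?_, hφ'c.smul hu2, ⟨K, hK⟩, ⟨K' * C', fun x => ?_⟩⟩
  · refine ((hφ x).comp_hasFDerivAt x (hu1 x)).congr_fderiv ?_
    simp
  · rw [norm_smul, Real.norm_eq_abs]
    exact mul_le_mul (hK' x) (hC' x) (norm_nonneg _) ((abs_nonneg _).trans (hK' x))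

end IsCb1

lemma isCb1_comp_inner {φ φ' : ℝ → ℝ} (k : E) (hφ : ∀ x, HasDerivAt φ (φ' x) x)
    (hφ'c : Continuous φ') {K K' : ℝ} (hK : ∀ x, |φ x| ≤ K) (hK' : ∀ x, |φ' x| ≤ K') :
    IsCb1 (fun z => φ ⟪k, z⟫) (fun z => φ' ⟪k, z⟫ • k) := by
  refine ⟨fun x => ?_, by fun_prop, ⟨K, fun x => hK _⟩, ⟨K' * ‖k‖, fun x => ?_⟩⟩
  · refine ((hφ _).comp_hasFDerivAt x (innerSL ℝ k).hasFDerivAt).congr_fderiv ?_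
    simp
  · rw [norm_smul, Real.norm_eq_abs]
    gcongr
    exact hK' _

/-- The cutoff `t ↦ 1 / (1 + (ε t)²)` of a linear functional. -/
lemma isCb1_cutoff_inner (k : E) {ε : ℝ} (hε : 0 ≤ ε) :
    IsCb1 (fun z => (1 + (ε * ⟪k, z⟫) ^ 2)⁻¹)
      (fun z => (-(2 * ε * (ε * ⟪k, z⟫)) / (1 + (ε * ⟪k, z⟫) ^ 2) ^ 2) • k) := by
  have hpos : ∀ t : ℝ, 0 < 1 + (ε * t) ^ 2 := fun t => by positivity
  refine isCb1_comp_inner (φ := fun t => (1 + (ε * t) ^ 2)⁻¹)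
    (φ' := fun t => -(2 * ε * (ε * t)) / (1 + (ε * t) ^ 2) ^ 2) (K := 1) (K' := ε) k
    (fun t => ?_) ?_ (fun t => ?_) (fun t => ?_)
  · have h1 : HasDerivAt (fun t : ℝ => 1 + (ε * t) ^ 2) (2 * ε * (ε * t)) t := by
      have := (((hasDerivAt_id t).const_mul ε).pow 2).const_add 1
      refine this.congr_deriv ?_
      simp
      ring
    exact h1.inv (hpos t).ne'
  · exact Continuous.div (by fun_prop) (by fun_prop) fun t => (pow_pos (hpos t) 2).ne'
  · rw [abs_of_pos (inv_pos.2 (hpos t))]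
    exact inv_le_one_of_one_le₀ (by nlinarith [sq_nonneg (ε * t)])
  · rw [abs_div, abs_neg, abs_mul, abs_of_pos (pow_pos (hpos t) 2), div_le_iff₀ (by positivity),
      abs_of_nonneg (by positivity : 0 ≤ 2 * ε), mul_comm 2 ε, mul_assoc]
    refine mul_le_mul_of_nonneg_left ?_ hε
    rw [← sq_abs (ε * t)]
    nlinarith [sq_nonneg (|ε * t| - 1), sq_nonneg (|ε * t| ^ 2)]

end Cb1

section Limit

lemma tendsto_integral_mul_of_tendsto_L1 {E : Type*} [TopologicalSpace E] [MeasurableSpace E]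
    [OpensMeasurableSpace E] {μ : Measure E} {f : E → ℝ} (hf : Continuous f) {C : ℝ}
    (hC : ∀ x, |f x| ≤ C) {r : E → ℝ} {rn : ℕ → E → ℝ} (hr : Integrable r μ)
    (hrn : ∀ n, Integrable (rn n) μ)
    (hL1 : Tendsto (fun n => ∫ z, |rn n z - r z| ∂μ) atTop (nhds 0)) :
    Tendsto (fun n => ∫ z, f z * rn n z ∂μ) atTop (nhds (∫ z, f z * r z ∂μ)) := by
  have hi : ∀ {s : E → ℝ}, Integrable s μ → Integrable (fun z => f z * s z) μ := fun hs =>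
    hs.bdd_mul hf.aestronglyMeasurable (Eventually.of_forall hC)
  rw [tendsto_iff_norm_sub_tendsto_zero]
  refine squeeze_zero (fun _ => norm_nonneg _) (fun n => ?_) (by simpa using hL1.const_mul C)
  rw [← integral_sub (hi (hrn n)) (hi hr), ← integral_const_mul]
  refine norm_integral_le_of_norm_le (((hrn n).sub hr).abs.const_mul C)
    (Eventually.of_forall fun z => ?_)
  rw [← mul_sub, norm_mul]
  exact mul_le_mul_of_nonneg_right (hC z) (abs_nonneg _)

variable {E : Type*} [NormedAddCommGroup E] [InnerProductSpace ℝ E]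
  [MeasurableSpace E] [BorelSpace E] {μ : Measure E}

lemma IsCb1.integrable [IsFiniteMeasure μ] {u : E → ℝ} {Du : E → E} (hu : IsCb1 u Du) :
    Integrable u μ := by
  obtain ⟨C, hC⟩ := hu.exists_bound
  exact Integrable.of_bound hu.continuous.aestronglyMeasurable C (Eventually.of_forall hC)

lemma tendsto_integral_mul_inner_of_tendsto_L1 {f : E → ℝ} (hf : Continuous f) {C : ℝ}
    (hC : ∀ x, |f x| ≤ C) (h : E) {r : E → E} {rn : ℕ → E → E} (hr : Integrable r μ)
    (hrn : ∀ n, Integrable (rn n) μ)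
    (hL1 : Tendsto (fun n => ∫ z, ‖rn n z - r z‖ ∂μ) atTop (nhds 0)) :
    Tendsto (fun n => ∫ z, f z * ⟪h, rn n z⟫ ∂μ) atTop (nhds (∫ z, f z * ⟪h, r z⟫ ∂μ)) := by
  refine tendsto_integral_mul_of_tendsto_L1 hf hC (hr.const_inner h)
    (fun n => (hrn n).const_inner h) ?_
  refine squeeze_zero (fun n => integral_nonneg fun _ => abs_nonneg _) (fun n => ?_)
    (by simpa using hL1.const_mul ‖h‖)
  rw [← integral_const_mul]
  refine integral_mono (((hrn n).const_inner h).sub (hr.const_inner h)).abs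
    (((hrn n).sub hr).norm.const_mul _) fun z => ?_
  simp only [← inner_sub_right]
  exact abs_real_inner_le_norm _ _

variable [SecondCountableTopology E]

lemma IsCb1.integrable_gradient [IsFiniteMeasure μ] {u : E → ℝ} {Du : E → E} (hu : IsCb1 u Du) :
    Integrable Du μ := by
  obtain ⟨C, hC⟩ := hu.exists_bound_gradient
  exact Integrable.of_bound hu.continuous_gradient.aestronglyMeasurable C (Eventually.of_forall hC)

variable [IsFiniteMeasure μ] {h k : E}
  {ρ : E → ℝ} {Φ : E → E} {ρn : ℕ → E → ℝ} {Dρn : ℕ → E → E}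

/-- Integration by parts passes to `L¹` limits of `C_b¹` functions, for test functions `g` making
`⟪k, ·⟫ * g` bounded. -/
lemma integral_parts_of_bounded
    (hIBP : ∀ (u : E → ℝ) (Du : E → E), IsCb1 u Du →
      ∫ z, ⟪h, Du z⟫ ∂μ = ∫ z, ⟪k, z⟫ * u z ∂μ)
    (hρ : Integrable ρ μ) (hΦ : Integrable Φ μ) (hCb : ∀ n, IsCb1 (ρn n) (Dρn n))
    (hL1 : Tendsto (fun n => ∫ z, |ρn n z - ρ z| ∂μ) atTop (nhds 0))
    (hL1D : Tendsto (fun n => ∫ z, ‖Dρn n z - Φ z‖ ∂μ) atTop (nhds 0))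
    {g : E → ℝ} {Dg : E → E} (hg : IsCb1 g Dg) {B : ℝ} (hB : ∀ z, |g z * ⟪k, z⟫| ≤ B) :
    ∫ z, (-⟪h, Dg z⟫ + g z * ⟪k, z⟫) * ρ z ∂μ = ∫ z, g z * ⟪h, Φ z⟫ ∂μ := by
  obtain ⟨C, hC⟩ := hg.exists_bound
  obtain ⟨C', hC'⟩ := hg.exists_bound_gradient
  have hgc := hg.continuous
  have hDgc := hg.continuous_gradient
  have hfc : Continuous fun z => -⟪h, Dg z⟫ + g z * ⟪k, z⟫ := by fun_prop
  have hfB : ∀ z, |-⟪h, Dg z⟫ + g z * ⟪k, z⟫| ≤ ‖h‖ * C' + B := fun z => by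
    refine (abs_add_le _ _).trans (add_le_add ?_ (hB z))
    rw [abs_neg]
    exact (abs_real_inner_le_norm _ _).trans (by gcongr; exact hC' z)
  refine tendsto_nhds_unique (tendsto_integral_mul_of_tendsto_L1 hfc hfB hρ
    (fun n => (hCb n).integrable) hL1) ?_
  refine (tendsto_integral_mul_inner_of_tendsto_L1 hgc hC h hΦ
    (fun n => (hCb n).integrable_gradient) hL1D).congr fun n => ?_
  have e1 := hIBP _ _ (hg.mul (hCb n))
  have i1 : Integrable (fun z => g z * ⟪h, Dρn n z⟫) μ :=
    ((hCb n).integrable_gradient.const_inner h).bdd_mul hgc.aestronglyMeasurable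
      (Eventually.of_forall hC)
  have i2 : Integrable (fun z => ⟪h, Dg z⟫ * ρn n z) μ := by
    refine (hCb n).integrable.bdd_mul (c := ‖h‖ * C') (by fun_prop)
      (Eventually.of_forall fun z => ?_)
    exact (norm_inner_le_norm _ _).trans (by gcongr; exact hC' z)
  have i3 : Integrable (fun z => (g z * ⟪k, z⟫) * ρn n z) μ :=
    (hCb n).integrable.bdd_mul (by fun_prop) (Eventually.of_forall hB)
  have e2 : ∫ z, ⟪h, g z • Dρn n z + ρn n z • Dg z⟫ ∂μ
      = ∫ z, g z * ⟪h, Dρn n z⟫ ∂μ + ∫ z, ⟪h, Dg z⟫ * ρn n z ∂μ := by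
    rw [← integral_add i1 i2]
    refine integral_congr_ae (Eventually.of_forall fun z => ?_)
    simp only [inner_add_right, real_inner_smul_right]
    ring
  have e3 : ∫ z, ⟪k, z⟫ * (g z * ρn n z) ∂μ = ∫ z, (g z * ⟪k, z⟫) * ρn n z ∂μ :=
    integral_congr_ae (Eventually.of_forall fun z => by ring)
  have e4 : ∫ z, (-⟪h, Dg z⟫ + g z * ⟪k, z⟫) * ρn n z ∂μ
      = ∫ z, (g z * ⟪k, z⟫) * ρn n z ∂μ - ∫ z, ⟪h, Dg z⟫ * ρn n z ∂μ := by
    rw [← integral_sub i3 i2]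
    exact integral_congr_ae (Eventually.of_forall fun z => by ring)
  rw [e4, ← e3, ← e1, e2]
  ring

/-- Integration by parts for `L¹` limits of `C_b¹` functions against `C_b¹` test functions. -/
lemma integral_parts
    (hIBP : ∀ (u : E → ℝ) (Du : E → E), IsCb1 u Du →
      ∫ z, ⟪h, Du z⟫ ∂μ = ∫ z, ⟪k, z⟫ * u z ∂μ)
    (hρ : Integrable ρ μ) (hΦ : Integrable Φ μ) (hCb : ∀ n, IsCb1 (ρn n) (Dρn n))
    (hL1 : Tendsto (fun n => ∫ z, |ρn n z - ρ z| ∂μ) atTop (nhds 0))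
    (hL1D : Tendsto (fun n => ∫ z, ‖Dρn n z - Φ z‖ ∂μ) atTop (nhds 0))
    (hXρ : Integrable (fun z => ⟪k, z⟫ * ρ z) μ)
    {g : E → ℝ} {Dg : E → E} (hg : IsCb1 g Dg) :
    ∫ z, (-⟪h, Dg z⟫ + g z * ⟪k, z⟫) * ρ z ∂μ = ∫ z, g z * ⟪h, Φ z⟫ ∂μ := by
  obtain ⟨C, hC⟩ := hg.exists_bound
  obtain ⟨C', hC'⟩ := hg.exists_bound_gradient
  have hgc := hg.continuous
  have hDgc := hg.continuous_gradient
  have hC0 : ∀ z : E, 0 ≤ C := fun z => (abs_nonneg _).trans (hC z)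
  set ε : ℕ → ℝ := fun n => 1 / ((n : ℝ) + 1) with hε
  have hε0 : ∀ n, 0 < ε n := fun n => by positivity
  have hε1 : ∀ n, ε n ≤ 1 := fun n => by
    rw [hε, div_le_one (by positivity)]
    linarith [(Nat.cast_nonneg n : (0 : ℝ) ≤ n)]
  have hεt : Tendsto ε atTop (nhds 0) := tendsto_one_div_add_atTop_nhds_zero_nat
  set θ : ℕ → E → ℝ := fun n z => (1 + (ε n * ⟪k, z⟫) ^ 2)⁻¹ with hθ
  set θ' : ℕ → E → ℝ := fun n z =>
    -(2 * ε n * (ε n * ⟪k, z⟫)) / (1 + (ε n * ⟪k, z⟫) ^ 2) ^ 2 with hθ'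
  have hpos : ∀ n z, 0 < 1 + (ε n * ⟪k, z⟫) ^ 2 := fun n z => by positivity
  have hθcb : ∀ n, IsCb1 (θ n) (fun z => θ' n z • k) := fun n => isCb1_cutoff_inner k (hε0 n).le
  have hθ0 : ∀ n z, 0 ≤ θ n z := fun n z => inv_nonneg.2 (hpos n z).le
  have hθ1 : ∀ n z, θ n z ≤ 1 := fun n z =>
    inv_le_one_of_one_le₀ (by nlinarith [sq_nonneg (ε n * ⟪k, z⟫)])
  have hθ'1 : ∀ n z, |θ' n z| ≤ 1 := fun n z => by
    simp only [hθ']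
    rw [abs_div, abs_neg, abs_mul, abs_of_pos (pow_pos (hpos n z) 2), div_le_iff₀ (by positivity),
      abs_of_nonneg (by have := hε0 n; positivity : 0 ≤ 2 * ε n), one_mul]
    have h1 : 2 * ε n * |ε n * ⟪k, z⟫| ≤ 2 * |ε n * ⟪k, z⟫| := by
      nlinarith [hε1 n, abs_nonneg (ε n * ⟪k, z⟫)]
    refine h1.trans ?_
    rw [← sq_abs (ε n * ⟪k, z⟫)]
    nlinarith [sq_nonneg (|ε n * ⟪k, z⟫| - 1), sq_nonneg (|ε n * ⟪k, z⟫| ^ 2)]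
  have hXθ : ∀ z, Tendsto (fun n => ε n * ⟪k, z⟫) atTop (nhds 0) := fun z => by
    simpa using hεt.mul_const ⟪k, z⟫
  have hθt : ∀ z, Tendsto (fun n => θ n z) atTop (nhds 1) := fun z => by
    have := (((hXθ z).pow 2).const_add 1).inv₀ (by norm_num)
    simpa using this
  have hθ't : ∀ z, Tendsto (fun n => θ' n z) atTop (nhds 0) := fun z => by
    have := ((((hεt.const_mul 2).mul (hXθ z))).neg).div
      ((((hXθ z).pow 2).const_add 1).pow 2) (by norm_num)
    simpa [hθ', Pi.div_def] using this
  have hn : ∀ n, ∫ z, (-⟪h, g z • θ' n z • k + θ n z • Dg z⟫ + (g z * θ n z) * ⟪k, z⟫) * ρ z ∂μ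
      = ∫ z, (g z * θ n z) * ⟪h, Φ z⟫ ∂μ := fun n => by
    refine integral_parts_of_bounded hIBP hρ hΦ hCb hL1 hL1D (hg.mul (hθcb n))
      (B := C * (ε n)⁻¹) fun z => ?_
    rw [mul_assoc, abs_mul]
    refine mul_le_mul (hC z) ?_ (abs_nonneg _) (hC0 z)
    have hb := hpos n z
    simp only [hθ]
    rw [abs_mul, abs_of_pos (inv_pos.2 hb), inv_mul_le_iff₀ hb, ← div_eq_mul_inv,
      le_div_iff₀ (hε0 n), ← abs_of_pos (hε0 n), ← abs_mul, mul_comm ⟪k, z⟫, abs_of_pos (hε0 n),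
      ← sq_abs (ε n * ⟪k, z⟫)]
    nlinarith [sq_nonneg (|ε n * ⟪k, z⟫| - 1)]
  have hlim1 : Tendsto (fun n => ∫ z, (g z * θ n z) * ⟪h, Φ z⟫ ∂μ) atTop
      (nhds (∫ z, g z * ⟪h, Φ z⟫ ∂μ)) := by
    refine tendsto_integral_of_dominated_convergence (fun z => C * ‖⟪h, Φ z⟫‖) (fun n => ?_)
      ((hΦ.const_inner h).norm.const_mul C) (fun n => Eventually.of_forall fun z => ?_)
      (Eventually.of_forall fun z => ?_)
    · exact (hgc.mul (hθcb n).continuous).aestronglyMeasurable.mul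
        (hΦ.const_inner h).aestronglyMeasurable
    · rw [norm_mul, norm_mul, Real.norm_eq_abs, Real.norm_eq_abs, abs_of_nonneg (hθ0 n z)]
      gcongr
      nlinarith [hC z, hθ0 n z, hθ1 n z, abs_nonneg (g z)]
    · simpa using ((hθt z).const_mul (g z)).mul_const ⟪h, Φ z⟫
  have hlim2 : Tendsto
      (fun n => ∫ z, (-⟪h, g z • θ' n z • k + θ n z • Dg z⟫ + (g z * θ n z) * ⟪k, z⟫) * ρ z ∂μ)
      atTop (nhds (∫ z, (-⟪h, Dg z⟫ + g z * ⟪k, z⟫) * ρ z ∂μ)) := by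
    refine tendsto_integral_of_dominated_convergence
      (fun z => (C * |⟪h, k⟫| + ‖h‖ * C') * |ρ z| + C * |⟪k, z⟫ * ρ z|) (fun n => ?_)
      ((hρ.abs.const_mul _).add (hXρ.abs.const_mul C)) (fun n => Eventually.of_forall fun z => ?_)
      (Eventually.of_forall fun z => ?_)
    · have h1 := (hθcb n).continuous
      have h2 := (hθcb n).continuous_gradient
      refine AEStronglyMeasurable.mul ?_ hρ.aestronglyMeasurable
      exact Continuous.aestronglyMeasurable (by fun_prop)
    · have b1 : |⟪h, g z • θ' n z • k + θ n z • Dg z⟫| ≤ C * |⟪h, k⟫| + ‖h‖ * C' := by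
        rw [inner_add_right, real_inner_smul_right, real_inner_smul_right, real_inner_smul_right]
        refine (abs_add_le _ _).trans (add_le_add ?_ ?_)
        · rw [abs_mul, abs_mul]
          refine mul_le_mul (hC z) ?_ (by positivity) (hC0 z)
          exact mul_le_of_le_one_left (abs_nonneg _) (hθ'1 n z)
        · rw [abs_mul, abs_of_nonneg (hθ0 n z)]
          refine (mul_le_of_le_one_left (abs_nonneg _) (hθ1 n z)).trans ?_
          exact (abs_real_inner_le_norm _ _).trans (by gcongr; exact hC' z)
      have b2 : |(g z * θ n z) * ⟪k, z⟫| ≤ C * |⟪k, z⟫| := by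
        rw [abs_mul, abs_mul, abs_of_nonneg (hθ0 n z)]
        gcongr
        nlinarith [hC z, hθ0 n z, hθ1 n z, abs_nonneg (g z)]
      rw [Real.norm_eq_abs, abs_mul, abs_mul ⟪k, z⟫, ← mul_assoc, ← add_mul]
      refine mul_le_mul_of_nonneg_right ((abs_add_le _ _).trans ?_) (abs_nonneg _)
      rw [abs_neg]
      exact add_le_add b1 b2
    · simp only [inner_add_right, real_inner_smul_right]
      have t1 := ((hθ't z).mul_const ⟪h, k⟫).const_mul (g z)
      have t2 := (hθt z).mul_const ⟪h, Dg z⟫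
      have t3 := ((hθt z).const_mul (g z)).mul_const ⟪k, z⟫
      have := (((t1.add t2).neg).add t3).mul_const (ρ z)
      simpa using this
  exact tendsto_nhds_unique (hlim2.congr hn) hlim1

end Limit
section Orlicz

lemma half_mul_sqrt_log_le_A12 {x : ℝ} (hx : 0 ≤ x) :
    x / 2 * Real.sqrt (Real.log (1 + x / 2)) ≤ A12 x := by
  have hc : ∀ {a b : ℝ}, 0 ≤ a → a ≤ b →
      IntervalIntegrable (fun s => Real.sqrt (Real.log (1 + s))) volume a b := by
    intro a b ha hab
    refine ContinuousOn.intervalIntegrable ?_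
    rw [Set.uIcc_of_le hab]
    refine (ContinuousOn.log (by fun_prop) fun s hs => ?_).sqrt
    have := hs.1
    exact ne_of_gt (by linarith)
  have hx2 : x / 2 ≤ x := by linarith
  rw [A12, ← intervalIntegral.integral_add_adjacent_intervals (hc le_rfl (by positivity))
    (hc (by positivity) hx2)]
  have h1 : 0 ≤ ∫ s in (0:ℝ)..(x / 2), Real.sqrt (Real.log (1 + s)) :=
    intervalIntegral.integral_nonneg (by positivity) fun _ _ => Real.sqrt_nonneg _
  have h2 : ∫ _ in (x / 2)..x, Real.sqrt (Real.log (1 + x / 2))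
      ≤ ∫ s in (x / 2)..x, Real.sqrt (Real.log (1 + s)) := by
    refine intervalIntegral.integral_mono_on hx2 intervalIntegrable_const
      (hc (by positivity) hx2) fun s hs => ?_
    gcongr
    exact hs.1
  rw [intervalIntegral.integral_const, smul_eq_mul] at h2
  have : x - x / 2 = x / 2 := by ring
  rw [this] at h2
  linarith

/-- A Young-type inequality for `A_{1/2}`. -/
lemma mul_le_A12_add_exp (a : ℝ) {x : ℝ} (hx : 0 ≤ x) :
    a * x ≤ 2 * A12 x + 2 * Real.exp (2 * a ^ 2) := by
  have hA := half_mul_sqrt_log_le_A12 hx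
  have hA0 : 0 ≤ A12 x := le_trans (by positivity) hA
  rcases le_total (x / 2) (Real.exp (a ^ 2)) with h | h
  · have h1 : a ≤ Real.exp (a ^ 2) := by
      have := Real.add_one_le_exp (a ^ 2)
      nlinarith [sq_nonneg (a - 1)]
    have h2 : Real.exp (2 * a ^ 2) = Real.exp (a ^ 2) * Real.exp (a ^ 2) := by
      rw [← Real.exp_add]; ring_nf
    have h3 : a * (x / 2) ≤ Real.exp (a ^ 2) * Real.exp (a ^ 2) :=
      mul_le_mul h1 h (by positivity) (Real.exp_pos _).le
    linarith
  · have h1 : a ≤ Real.sqrt (Real.log (1 + x / 2)) := by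
      refine Real.le_sqrt_of_sq_le ?_
      rw [Real.le_log_iff_exp_le (by positivity)]
      linarith
    have h2 : x / 2 * a ≤ x / 2 * Real.sqrt (Real.log (1 + x / 2)) := by gcongr
    have := Real.exp_pos (2 * a ^ 2)
    linarith

lemma integrable_mul_of_integrable_A12 {Ω : Type*} [MeasurableSpace Ω] {μ : Measure Ω}
    {X ρ : Ω → ℝ} (hX : AEStronglyMeasurable X μ) (hρ : AEStronglyMeasurable ρ μ)
    (hA : Integrable (fun z => A12 |ρ z|) μ) {c : ℝ} (hc : 0 < c)
    (hexp : Integrable (fun z => Real.exp (c * X z ^ 2)) μ) :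
    Integrable (fun z => X z * ρ z) μ := by
  set b := Real.sqrt (c / 2) with hb
  have hb0 : 0 < b := Real.sqrt_pos.2 (by positivity)
  have hb2 : b ^ 2 = c / 2 := Real.sq_sqrt (by positivity)
  refine (((hA.const_mul 2).add (hexp.const_mul 2)).const_mul b⁻¹).mono' (hX.mul hρ)
    (Eventually.of_forall fun z => ?_)
  have := mul_le_A12_add_exp (b * |X z|) (abs_nonneg (ρ z))
  have e : 2 * (b * |X z|) ^ 2 = c * X z ^ 2 := by
    rw [mul_pow, hb2, sq_abs]; ring
  rw [e] at this
  rw [Real.norm_eq_abs, abs_mul, le_inv_mul_iff₀ hb0, ← mul_assoc]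
  exact this

end Orlicz

section Density

variable {E : Type*} [NormedAddCommGroup E] [InnerProductSpace ℝ E] [CompleteSpace E]
  [SecondCountableTopology E] [MeasurableSpace E] [BorelSpace E] {μ : Measure E}

/-- An integrable function is determined by its integrals against `C_b¹` functions. -/
lemma ae_eq_zero_of_forall_integral_isCb1_mul_eq_zero [IsFiniteMeasure μ] {f : E → ℝ}
    (hf : Integrable f μ)
    (h : ∀ (g : E → ℝ) (Dg : E → E), IsCb1 g Dg → ∫ z, g z * f z ∂μ = 0) : f =ᵐ[μ] 0 := by
  set νp := μ.withDensity fun z => ENNReal.ofReal (f z) with hνp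
  set νm := μ.withDensity fun z => ENNReal.ofReal (-f z) with hνm
  have : IsFiniteMeasure νp := isFiniteMeasure_withDensity_ofReal hf.2
  have : IsFiniteMeasure νm := isFiniteMeasure_withDensity_ofReal hf.neg.2
  have hν : νp = νm := by
    refine Measure.ext_of_charFun ?_
    ext w
    have hexp : ∀ {r : E → ℝ}, Integrable r μ →
        Integrable (fun z => (r z : ℂ) * Complex.exp ((⟪z, w⟫ : ℝ) * Complex.I)) μ := by
      intro r hr
      refine hr.ofReal.mul_bdd (c := 1) (by fun_prop) (Eventually.of_forall fun z => ?_)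
      rw [Complex.norm_exp_ofReal_mul_I]
    have hch : ∀ r : E → ℝ, Integrable r μ →
        charFun (μ.withDensity fun z => ENNReal.ofReal (r z)) w
          = ∫ z, ((max (r z) 0 : ℝ) : ℂ) * Complex.exp ((⟪z, w⟫ : ℝ) * Complex.I) ∂μ := by
      intro r hr
      rw [charFun_apply, integral_withDensity_eq_integral_toReal_smul₀
        hr.aestronglyMeasurable.aemeasurable.ennreal_ofReal (Eventually.of_forall fun z => by simp)]
      simp only [ENNReal.toReal_ofReal', Complex.real_smul]
    rw [hνp, hνm, hch f hf, hch (fun z => -f z) hf.neg, ← sub_eq_zero,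
      ← integral_sub (hexp hf.pos_part) (hexp hf.fun_neg.pos_part)]
    have hcos := h _ _ (isCb1_comp_inner (φ := Real.cos) (φ' := fun x => -Real.sin x) (K := 1)
      (K' := 1) w Real.hasDerivAt_cos (by fun_prop) Real.abs_cos_le_one
      (fun x => by rw [abs_neg]; exact Real.abs_sin_le_one x))
    have hsin := h _ _ (isCb1_comp_inner (φ := Real.sin) (φ' := Real.cos) (K := 1)
      (K' := 1) w Real.hasDerivAt_sin (by fun_prop) Real.abs_sin_le_one Real.abs_cos_le_one)
    have ic : Integrable (fun z => Real.cos ⟪w, z⟫ * f z) μ :=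
      hf.bdd_mul (c := 1) (by fun_prop) (Eventually.of_forall fun z => Real.abs_cos_le_one _)
    have is : Integrable (fun z => Real.sin ⟪w, z⟫ * f z) μ :=
      hf.bdd_mul (c := 1) (by fun_prop) (Eventually.of_forall fun z => Real.abs_sin_le_one _)
    have e : ∀ z, ((max (f z) 0 : ℝ) : ℂ) * Complex.exp ((⟪z, w⟫ : ℝ) * Complex.I)
        - ((max (-f z) 0 : ℝ) : ℂ) * Complex.exp ((⟪z, w⟫ : ℝ) * Complex.I)
        = ((Real.cos ⟪w, z⟫ * f z : ℝ) : ℂ) + ((Real.sin ⟪w, z⟫ * f z : ℝ) : ℂ) * Complex.I := by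
      intro z
      have hm : max (f z) 0 - max (-f z) 0 = f z := by
        rcases le_total (f z) 0 with h0 | h0
        · rw [max_eq_right h0, max_eq_left (by linarith)]; ring
        · rw [max_eq_left h0, max_eq_right (by linarith)]; ring
      rw [← sub_mul, ← Complex.ofReal_sub, hm, Complex.exp_mul_I, real_inner_comm,
        ← Complex.ofReal_cos, ← Complex.ofReal_sin]
      push_cast
      ring
    simp_rw [e]
    rw [integral_add ic.ofReal (is.ofReal.mul_const _), integral_mul_const, integral_complex_ofReal,
      integral_complex_ofReal, hcos, hsin]
    simp
  refine hf.ae_eq_zero_of_forall_setIntegral_eq_zero fun s hs _ => ?_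
  rw [integral_eq_lintegral_pos_part_sub_lintegral_neg_part hf.integrableOn,
    ← withDensity_apply _ hs, ← withDensity_apply _ hs, ← hνp, ← hνm, hν, sub_self]

/-- Finite combinations of basis vectors with `C_b¹` coefficients are dense in `L²`, hence
approximate `L²` vector fields in `L¹`. -/
lemma exists_isCb1_integral_norm_sub_lt [IsProbabilityMeasure μ] {ι : Type*} [Countable ι]
    (b : HilbertBasis ι ℝ E) {F : E → E} (hF : MemLp F 2 μ) {ε : ℝ} (hε : 0 < ε) :
    ∃ (m : ℕ) (g : Fin m → E → ℝ) (Dg : Fin m → E → E) (j : Fin m → ι),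
      (∀ i, IsCb1 (g i) (Dg i)) ∧ ∫ z, ‖∑ i, g i z • b (j i) - F z‖ ∂μ < ε := by
  set T : Set (Lp E 2 μ) :=
    {f | ∃ (g : E → ℝ) (Dg : E → E) (j : ι), IsCb1 g Dg ∧ f =ᵐ[μ] fun z => g z • b j} with hT
  have htop : (Submodule.span ℝ T).topologicalClosure = ⊤ := by
    rw [Submodule.topologicalClosure_eq_top_iff, Submodule.eq_bot_iff]
    intro ψ hψ
    have hψi : Integrable ψ μ := (Lp.memLp ψ).integrable one_le_two
    have hz : ∀ j, ∀ᵐ z ∂μ, ⟪b j, ψ z⟫ = 0 := by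
      intro j
      refine ae_eq_zero_of_forall_integral_isCb1_mul_eq_zero (hψi.const_inner (b j)) ?_
      intro g Dg hg
      obtain ⟨C, hC⟩ := hg.exists_bound
      have hL : MemLp (fun z => g z • b j) 2 μ := by
        have := hg.continuous
        refine MemLp.of_bound (by fun_prop) (C * ‖b j‖) (Eventually.of_forall fun z => ?_)
        rw [norm_smul]
        exact mul_le_mul_of_nonneg_right (hC z) (norm_nonneg _)
      have h0 := (Submodule.mem_orthogonal _ _).1 hψ (hL.toLp _)
        (Submodule.subset_span ⟨g, Dg, j, hg, hL.coeFn_toLp⟩)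
      rw [L2.inner_def] at h0
      rw [← h0]
      refine integral_congr_ae ?_
      filter_upwards [hL.coeFn_toLp] with z hz
      rw [hz, real_inner_smul_left]
    rw [Lp.eq_zero_iff_ae_eq_zero]
    filter_upwards [ae_all_iff.2 hz] with z hz
    refine (b.hasSum_repr (ψ z)).unique ?_
    simp [b.repr_apply_apply, hz, hasSum_zero]
  have hmem : hF.toLp F ∈ closure (Submodule.span ℝ T : Set (Lp E 2 μ)) := by
    rw [← Submodule.topologicalClosure_coe, htop]
    trivial
  obtain ⟨f, hfS, hfd⟩ := Metric.mem_closure_iff.1 hmem ε hε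
  obtain ⟨m, c, t, rfl⟩ := Submodule.mem_span_set'.1 hfS
  choose g Dg j hg hgt using fun i => (t i).2
  refine ⟨m, fun i z => c i * g i z, fun i z => c i • Dg i z, j, fun i => (hg i).const_mul _, ?_⟩
  have hae : (fun z => ∑ i, (c i * g i z) • b (j i) - F z)
      =ᵐ[μ] (∑ i, c i • (t i : Lp E 2 μ) - hF.toLp F : Lp E 2 μ) := by
    have h1 : ∀ᵐ z ∂μ, ∀ i, (c i • (t i : Lp E 2 μ) : Lp E 2 μ) z = (c i * g i z) • b (j i) := by
      refine ae_all_iff.2 fun i => ?_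
      filter_upwards [hgt i, Lp.coeFn_smul (c i) (t i : Lp E 2 μ)] with z h1 h2
      rw [h2, Pi.smul_apply, h1, smul_smul]
    filter_upwards [h1, Lp.coeFn_sub (∑ i, c i • (t i : Lp E 2 μ)) (hF.toLp F), hF.coeFn_toLp,
      Lp.coeFn_finsetSum Finset.univ (fun i => c i • (t i : Lp E 2 μ))] with z h1 h2 h3 h4
    rw [h2, Pi.sub_apply, h3, h4]
    simp [h1]
  set d : Lp E 2 μ := ∑ i, c i • (t i : Lp E 2 μ) - hF.toLp F with hd
  have h1 : ∫ z, ‖∑ i, (c i * g i z) • b (j i) - F z‖ ∂μ = ∫ z, ‖d z‖ ∂μ :=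
    integral_congr_ae (by filter_upwards [hae] with z hz; rw [hz])
  have h2 : ∫ z, ‖d z‖ ∂μ ≤ ‖d‖ := by
    rw [integral_norm_eq_lintegral_enorm (Lp.memLp d).1, ← eLpNorm_one_eq_lintegral_enorm,
      Lp.norm_def]
    exact ENNReal.toReal_mono (Lp.memLp d).2.ne
      (eLpNorm_le_eLpNorm_of_exponent_le one_le_two (Lp.memLp d).1)
  rw [h1]
  refine h2.trans_lt ?_
  rwa [dist_comm, dist_eq_norm] at hfd

end Density
section Approximation

variable {E : Type*} [NormedAddCommGroup E] [InnerProductSpace ℝ E]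

/-- The smooth weight `(ε² + |G|²)^{-1/2}` attached to a `C_b¹` field `G = ∑ i, g i • l i`. -/
lemma isCb1_inv_sqrt_add_norm_sq {m : ℕ} {g : Fin m → E → ℝ} {Dg : Fin m → E → E}
    (l : Fin m → E) (hg : ∀ i, IsCb1 (g i) (Dg i)) {ε : ℝ} (hε : 0 < ε) :
    ∃ Dw : E → E, IsCb1 (fun z => (Real.sqrt (ε ^ 2 + ‖∑ i, g i z • l i‖ ^ 2))⁻¹) Dw := by
  have hq := IsCb1.sum Finset.univ fun i => IsCb1.sum Finset.univ fun j =>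
    ((hg i).mul (hg j)).const_mul ⟪l i, l j⟫
  have e : ∀ z, ∑ i, ∑ j, ⟪l i, l j⟫ * (g i z * g j z) = ‖∑ i, g i z • l i‖ ^ 2 := by
    intro z
    rw [← real_inner_self_eq_norm_sq, sum_inner]
    refine Finset.sum_congr rfl fun i _ => ?_
    rw [inner_sum]
    refine Finset.sum_congr rfl fun j _ => ?_
    rw [real_inner_smul_left, real_inner_smul_right]
    ring
  simp_rw [e] at hq
  have hε2 : 0 < ε ^ 2 := by positivity
  have hpos : ∀ z, 0 < ε ^ 2 + ‖∑ i, g i z • l i‖ ^ 2 := fun z => by positivity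
  have hsq : ∀ z, ε ≤ Real.sqrt (ε ^ 2 + ‖∑ i, g i z • l i‖ ^ 2) := fun z =>
    Real.le_sqrt_of_sq_le (le_add_of_nonneg_right (by positivity))
  have hc := hq.continuous
  refine ⟨_, hq.comp (φ := fun t => (Real.sqrt (ε ^ 2 + t))⁻¹)
    (φ' := fun t => -(1 / (2 * Real.sqrt (ε ^ 2 + t))) / (Real.sqrt (ε ^ 2 + t)) ^ 2)
    (K := ε⁻¹) (K' := 1 / (2 * ε) / ε ^ 2)
    (fun x => ?_) ?_ (fun x => ?_) (fun x => ?_)⟩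
  · have h1 : HasDerivAt (fun t : ℝ => ε ^ 2 + t) 1 (‖∑ i, g i x • l i‖ ^ 2) :=
      (hasDerivAt_id _).const_add _
    exact (h1.sqrt (hpos x).ne').inv (Real.sqrt_pos.2 (hpos x)).ne'
  · have hne : ∀ z, Real.sqrt (ε ^ 2 + ‖∑ i, g i z • l i‖ ^ 2) ≠ 0 := fun z =>
      (Real.sqrt_pos.2 (hpos z)).ne'
    have hs : Continuous fun z => Real.sqrt (ε ^ 2 + ‖∑ i, g i z • l i‖ ^ 2) := by fun_prop
    exact ((continuous_const.div (continuous_const.mul hs) fun z =>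
      mul_ne_zero two_ne_zero (hne z)).neg).div (hs.pow 2) fun z => pow_ne_zero 2 (hne z)
  · have := hsq x
    rw [abs_of_nonneg (by positivity)]
    gcongr
  · have := hsq x
    rw [abs_div, abs_neg, abs_of_nonneg (by positivity), abs_of_nonneg (by positivity)]
    gcongr

variable [CompleteSpace E] [SecondCountableTopology E] [MeasurableSpace E] [BorelSpace E]
  {μ : Measure E}

/-- The `L¹` norm of a vector field is approximated by pairing it with `C_b¹` fields of norm at
most one that take values in the span of a Hilbert basis. -/
lemma exists_isCb1_integral_norm_sub_le [IsProbabilityMeasure μ] {ι : Type*} [Countable ι]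
    (b : HilbertBasis ι ℝ E) {Φ F : E → E} (hΦ : Integrable Φ μ) (hF : MemLp F 2 μ) {ε : ℝ}
    (hε : 0 < ε) (hFΦ : ∫ z, ‖F z - Φ z‖ ∂μ ≤ ε) :
    ∃ (m : ℕ) (g : Fin m → E → ℝ) (Dg : Fin m → E → E) (j : Fin m → ι),
      (∀ i, IsCb1 (g i) (Dg i)) ∧ (∀ z, ‖∑ i, g i z • b (j i)‖ ≤ 1) ∧
      ∫ z, ‖Φ z‖ ∂μ - 5 * ε ≤ ∫ z, ⟪∑ i, g i z • b (j i), Φ z⟫ ∂μ := by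
  obtain ⟨m, g, Dg, j, hg, hgF⟩ := exists_isCb1_integral_norm_sub_lt b hF hε
  obtain ⟨Dw, hw⟩ := isCb1_inv_sqrt_add_norm_sq (fun i => b (j i)) hg hε
  set G : E → E := fun z => ∑ i, g i z • b (j i) with hG
  set w : E → ℝ := fun z => (Real.sqrt (ε ^ 2 + ‖G z‖ ^ 2))⁻¹ with hwdef
  have hwG : ∀ z, ∑ i, (w z * g i z) • b (j i) = w z • G z := fun z => by
    simp only [hG, Finset.smul_sum, smul_smul]
  have hGi : Integrable G μ := by
    refine integrable_finsetSum _ fun i _ => ?_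
    exact (hg i).integrable.smul_const _
  have hFi : Integrable F μ := hF.integrable one_le_two
  have hpos : ∀ z, 0 < Real.sqrt (ε ^ 2 + ‖G z‖ ^ 2) := fun z => Real.sqrt_pos.2 (by positivity)
  have hw1 : ∀ z, ‖w z • G z‖ ≤ 1 := fun z => by
    rw [norm_smul, Real.norm_eq_abs, abs_of_pos (inv_pos.2 (hpos z)), inv_mul_le_iff₀ (hpos z),
      mul_one]
    exact Real.le_sqrt_of_sq_le (le_add_of_nonneg_left (by positivity))
  have hwGc : AEStronglyMeasurable (fun z => w z • G z) μ :=
    hw.continuous.aestronglyMeasurable.smul hGi.aestronglyMeasurable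
  refine ⟨m, fun i z => w z * g i z, _, j, fun i => hw.mul (hg i), fun z => ?_, ?_⟩
  · rw [hwG]
    exact hw1 z
  · simp_rw [hwG]
    have hpt : ∀ z, ‖Φ z‖ - ε - 2 * (‖G z - F z‖ + ‖F z - Φ z‖) ≤ ⟪w z • G z, Φ z⟫ := by
      intro z
      have h1 : ⟪w z • G z, Φ z⟫ = w z * ‖G z‖ ^ 2 - ⟪w z • G z, G z - Φ z⟫ := by
        rw [inner_sub_right, real_inner_smul_left (G z) (G z), real_inner_self_eq_norm_sq]
        ring
      have h2 : ⟪w z • G z, G z - Φ z⟫ ≤ ‖G z - Φ z‖ :=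
        (real_inner_le_norm _ _).trans (mul_le_of_le_one_left (norm_nonneg _) (hw1 z))
      have h3 : ‖G z‖ - ε ≤ w z * ‖G z‖ ^ 2 := by
        rw [hwdef, le_inv_mul_iff₀ (hpos z)]
        have hs : Real.sqrt (ε ^ 2 + ‖G z‖ ^ 2) ≤ ε + ‖G z‖ :=
          Real.sqrt_le_iff.2 ⟨by positivity, by nlinarith [mul_nonneg hε.le (norm_nonneg (G z))]⟩
        rcases le_total (‖G z‖) ε with h | h
        · nlinarith [hpos z, sq_nonneg ‖G z‖]
        · nlinarith [hpos z]
      have h4 : ‖Φ z‖ ≤ ‖G z‖ + ‖G z - Φ z‖ := by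
        have := norm_sub_le (G z) (G z - Φ z)
        rwa [sub_sub_cancel] at this
      have h5 : ‖G z - Φ z‖ ≤ ‖G z - F z‖ + ‖F z - Φ z‖ := norm_sub_le_norm_sub_add_norm_sub _ _ _
      linarith
    have i1 := (hGi.sub hFi).norm
    have i2 := (hFi.sub hΦ).norm
    have hle := integral_mono (μ := μ)
      ((hΦ.norm.sub (integrable_const ε)).sub ((i1.add i2).const_mul 2))
      (hΦ.norm.mono' (hwGc.inner hΦ.aestronglyMeasurable) (Eventually.of_forall fun z =>
        (norm_inner_le_norm _ _).trans (mul_le_of_le_one_left (norm_nonneg _) (hw1 z)))) hpt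
    have he : ∫ z, (‖Φ z‖ - ε - 2 * (‖G z - F z‖ + ‖F z - Φ z‖)) ∂μ
        = ∫ z, ‖Φ z‖ ∂μ - ε - 2 * (∫ z, ‖G z - F z‖ ∂μ + ∫ z, ‖F z - Φ z‖ ∂μ) := by
      have e1 := integral_sub (μ := μ) (hΦ.norm.sub (integrable_const ε))
        ((i1.add i2).const_mul 2)
      have e2 := integral_sub (μ := μ) hΦ.norm (integrable_const ε)
      have e3 := integral_add (μ := μ) i1 i2
      have e4 := integral_const_mul (μ := μ) (2 : ℝ) (fun z => ‖G z - F z‖ + ‖F z - Φ z‖)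
      simp only [Pi.sub_apply, Pi.add_apply, integral_const, probReal_univ, one_smul] at e1 e2 e3 e4
      rw [e1, e2, e4, e3]
    have hle' : ∫ z, (‖Φ z‖ - ε - 2 * (‖G z - F z‖ + ‖F z - Φ z‖)) ∂μ
        ≤ ∫ z, ⟪w z • G z, Φ z⟫ ∂μ := hle
    rw [he] at hle'
    linarith

end Approximation

section Operators

variable {E : Type*} [NormedAddCommGroup E] [InnerProductSpace ℝ E]

lemma HilbertBasis.inner_tsum_smul {ι : Type*} (b : HilbertBasis ι ℝ E) {c : ι → ℝ}
    (hc : Summable fun j => c j ^ 2) (i : ι) : ⟪∑' j, c j • b j, b i⟫ = c i := by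
  have hmem : Memℓp c 2 := memℓp_gen (by simpa using hc)
  have h1 := b.hasSum_repr_symm ⟨c, hmem⟩
  rw [h1.tsum_eq, real_inner_comm, ← b.repr_apply_apply, LinearIsometryEquiv.apply_symm_apply]

variable (b : HilbertBasis ℕ ℝ E) {α : ℕ → ℝ} {δ : ℝ}

lemma summable_inner_sq (x : E) : Summable fun j => ⟪x, b j⟫ ^ 2 := by
  refine (b.summable_inner_mul_inner x x).congr fun j => ?_
  rw [real_inner_comm (b j) x, sq]

lemma inner_Aop {h : E} (hh : memDA b α h) (i : ℕ) : ⟪Aop b α h, b i⟫ = α i * ⟪h, b i⟫ :=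
  b.inner_tsum_smul (c := fun j => α j * ⟪h, b j⟫) (by simpa only [mul_pow, memDA] using hh) i

lemma inner_Qop (hδ : 0 < δ) (hα : ∀ j, δ ≤ α j) (w : E) (i : ℕ) :
    ⟪Qop b α w, b i⟫ = (2 * α i)⁻¹ * ⟪w, b i⟫ := by
  refine b.inner_tsum_smul (c := fun j => (2 * α j)⁻¹ * ⟪w, b j⟫) ?_ i
  refine Summable.of_nonneg_of_le (fun j => sq_nonneg _) (fun j => ?_)
    ((summable_inner_sq b w).mul_left (((2 * δ)⁻¹) ^ 2))
  have := hα j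
  have hαj : 0 < α j := hδ.trans_le this
  rw [mul_pow]
  gcongr

lemma hasSum_inner_Qop_self (hδ : 0 < δ) (hα : ∀ j, δ ≤ α j) (w : E) :
    HasSum (fun j => (2 * α j)⁻¹ * ⟪w, b j⟫ ^ 2) ⟪Qop b α w, w⟫ := by
  refine (b.hasSum_inner_mul_inner (Qop b α w) w).congr_fun fun j => ?_
  rw [inner_Qop b hδ hα, real_inner_comm w (b j)]
  ring

lemma inner_Qop_self_nonneg (hδ : 0 < δ) (hα : ∀ j, δ ≤ α j) (w : E) : 0 ≤ ⟪Qop b α w, w⟫ :=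
  (hasSum_inner_Qop_self b hδ hα w).nonneg fun j => by
    have : 0 < α j := hδ.trans_le (hα j)
    positivity

lemma hasSum_inner_two_smul_Aop {h : E} (hh : memDA b α h) :
    HasSum (fun j => 2 * α j * ⟪h, b j⟫ ^ 2) ⟪h, (2 : ℝ) • Aop b α h⟫ := by
  refine (b.hasSum_inner_mul_inner h ((2 : ℝ) • Aop b α h)).congr_fun fun j => ?_
  rw [real_inner_smul_right, real_inner_comm (Aop b α h) (b j), inner_Aop b hh]
  ring

lemma inner_Qop_sub_smul (hδ : 0 < δ) (hα : ∀ j, δ ≤ α j) {h : E} (hh : memDA b α h) (w : E)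
    (c : ℝ) :
    ⟪Qop b α (w - c • (2 : ℝ) • Aop b α h), w - c • (2 : ℝ) • Aop b α h⟫
      = ⟪Qop b α w, w⟫ - 2 * c * ⟪h, w⟫ + c ^ 2 * ⟪h, (2 : ℝ) • Aop b α h⟫ := by
  refine (hasSum_inner_Qop_self b hδ hα _).unique ?_
  refine ((((hasSum_inner_Qop_self b hδ hα w).sub
    ((b.hasSum_inner_mul_inner h w).mul_left (2 * c))).add
    ((hasSum_inner_two_smul_Aop b hh).mul_left (c ^ 2)))).congr_fun fun j => ?_
  have hαj : α j ≠ 0 := (hδ.trans_le (hα j)).ne'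
  rw [inner_sub_left, real_inner_smul_left, real_inner_smul_left, inner_Aop b hh,
    real_inner_comm w (b j)]
  field_simp
  ring

lemma eq_zero_of_inner_two_smul_Aop_le (hδ : 0 < δ) (hα : ∀ j, δ ≤ α j) {h : E}
    (hh : memDA b α h) (h0 : ⟪h, (2 : ℝ) • Aop b α h⟫ ≤ 0) : h = 0 := by
  have h1 : HasSum (fun j => ⟪h, b j⟫ * ⟪b j, h⟫) ⟪h, h⟫ := b.hasSum_inner_mul_inner h h
  have h2 := hasSum_le (fun j => ?_) (h1.mul_left (2 * δ)) (hasSum_inner_two_smul_Aop b hh)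
  · have h3 : ⟪h, h⟫ ≤ 0 := by nlinarith
    exact inner_self_eq_zero.1 (h3.antisymm real_inner_self_nonneg)
  · rw [real_inner_comm h (b j), ← sq]
    have := hα j
    gcongr

lemma memDA_basis (j : ℕ) : memDA b α (b j) := by
  refine summable_of_ne_finset_zero (s := {j}) fun i hi => ?_
  rw [b.orthonormal.inner_eq_zero (by simpa [eq_comm] using hi)]
  simp

variable [SecondCountableTopology E] [MeasurableSpace E] [BorelSpace E]
  {μ : Measure E}

/-- Finite-dimensional Gaussian marginals determine the characteristic function. -/
lemma charFun_eq_of_map_inner_eq_gaussianReal {q : E → ℝ} (hq : ∀ w, 0 ≤ q w)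
    (hGauss : ∀ w : E, μ.map (fun x => ⟪x, w⟫)
      = ProbabilityTheory.gaussianReal 0 (Real.toNNReal (q w))) (w : E) :
    charFun μ w = Complex.exp (-(q w : ℂ) / 2) := by
  have h1 : charFun μ w = charFun (μ.map (fun x => ⟪x, w⟫)) 1 := by
    rw [charFun_apply, charFun_apply_real,
      integral_map (Measurable.aemeasurable (by fun_prop)) (by fun_prop)]
    simp
  rw [h1, hGauss, ProbabilityTheory.charFun_gaussianReal]
  congr 1
  have : (((q w).toNNReal : ℝ) : ℂ) = q w := by rw [Real.coe_toNNReal _ (hq w)]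
  rw [this]
  push_cast
  ring

lemma exists_integrable_exp_inner_sq {w : E} {v : ℝ≥0}
    (hw : μ.map (fun x => ⟪x, w⟫) = ProbabilityTheory.gaussianReal 0 v) :
    ∃ c : ℝ, 0 < c ∧ Integrable (fun z => Real.exp (c * ⟪w, z⟫ ^ 2)) μ := by
  obtain ⟨c, hc, hi⟩ := ProbabilityTheory.IsGaussian.exists_integrable_exp_sq
    (ProbabilityTheory.gaussianReal 0 v)
  refine ⟨c, hc, ?_⟩
  rw [← hw, integrable_map_measure (by fun_prop) (Measurable.aemeasurable (by fun_prop))] at hi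
  refine hi.congr (Eventually.of_forall fun z => ?_)
  simp [real_inner_comm]

lemma integrable_inner_of_map_eq_gaussianReal {w : E} {v : ℝ≥0}
    (hw : μ.map (fun x => ⟪x, w⟫) = ProbabilityTheory.gaussianReal 0 v) :
    Integrable (fun z => ⟪w, z⟫) μ := by
  have hi := (ProbabilityTheory.memLp_id_gaussianReal (μ := 0) (v := v) 1).integrable le_rfl
  rw [← hw, integrable_map_measure (by fun_prop) (Measurable.aemeasurable (by fun_prop))] at hi
  refine hi.congr (Eventually.of_forall fun z => ?_)
  simp [real_inner_comm]

variable [CompleteSpace E] [IsProbabilityMeasure μ]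

/-- Integration by parts for the Gaussian measure with covariance `Q`, in a direction of
`D(A)`. -/
lemma integral_inner_gradient_eq_of_memDA (hδ : 0 < δ)
    (hα : ∀ j, δ ≤ α j)
    (hGauss : ∀ h : E, μ.map (fun x => ⟪x, h⟫)
      = ProbabilityTheory.gaussianReal 0 (Real.toNNReal ⟪Qop b α h, h⟫))
    {h : E} (hh : memDA b α h) {u : E → ℝ} {Du : E → E} (hu : IsCb1 u Du) :
    ∫ z, ⟪h, Du z⟫ ∂μ = ∫ z, ⟪(2 : ℝ) • Aop b α h, z⟫ * u z ∂μ := by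
  rcases le_or_gt ⟪h, (2 : ℝ) • Aop b α h⟫ 0 with hs | hs
  · have h0 := eq_zero_of_inner_two_smul_Aop_le b hδ hα hh hs
    subst h0
    simp [Aop]
  · set s : ℝ≥0 := ⟨⟪h, (2 : ℝ) • Aop b α h⟫, hs.le⟩ with hsdef
    have hs0 : s ≠ 0 := fun h0 => hs.ne' (congrArg NNReal.toReal h0)
    exact integral_inner_gradient_eq (q := fun w => ⟪Qop b α w, w⟫)
      (charFun_eq_of_map_inner_eq_gaussianReal (inner_Qop_self_nonneg b hδ hα) hGauss) hs0
      (inner_Qop_sub_smul b hδ hα hh) rfl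
      (integrable_inner_of_map_eq_gaussianReal (hGauss _)) hu

/-- The Gaussian integration by parts formula for `W^{1,1}` functions and fields in
`(C_b¹)_{D(A)}`. -/
lemma integral_Dstar_mul_eq (hδ : 0 < δ) (hα : ∀ j, δ ≤ α j)
    (hGauss : ∀ h : E, μ.map (fun x => ⟪x, h⟫)
      = ProbabilityTheory.gaussianReal 0 (Real.toNNReal ⟪Qop b α h, h⟫))
    {ρ : E → ℝ} (hρ : Integrable ρ μ) {Φ : E → E} (hΦ : Integrable Φ μ)
    {ρn : ℕ → E → ℝ} {Dρn : ℕ → E → E} (hCb : ∀ k, IsCb1 (ρn k) (Dρn k))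
    (hL1 : Tendsto (fun k => ∫ z, |ρn k z - ρ z| ∂μ) atTop (nhds 0))
    (hL1D : Tendsto (fun k => ∫ z, ‖Dρn k z - Φ z‖ ∂μ) atTop (nhds 0))
    (hA : Integrable (fun z => A12 |ρ z|) μ)
    {m : ℕ} {g : Fin m → E → ℝ} {Dg : Fin m → E → E} {l : Fin m → E}
    (hg : ∀ i, IsCb1 (g i) (Dg i)) (hl : ∀ i, memDA b α (l i)) :
    ∫ z, Dstar b α g Dg l z * ρ z ∂μ = ∫ z, ⟪∑ i, g i z • l i, Φ z⟫ ∂μ := by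
  set k : Fin m → E := fun i => (2 : ℝ) • Aop b α (l i) with hk
  have hkρ : ∀ i, Integrable (fun z => ⟪k i, z⟫ * ρ z) μ := fun i => by
    obtain ⟨c, hc, hexp⟩ := exists_integrable_exp_inner_sq (hGauss (k i))
    exact integrable_mul_of_integrable_A12 (by fun_prop) hρ.aestronglyMeasurable hA hc hexp
  have hL : ∀ i, Integrable (fun z => (-⟪l i, Dg i z⟫ + g i z * ⟪k i, z⟫) * ρ z) μ := fun i => by
    obtain ⟨C, hC⟩ := (hg i).exists_bound
    obtain ⟨C', hC'⟩ := (hg i).exists_bound_gradient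
    have hDgc := (hg i).continuous_gradient
    have h1 : Integrable (fun z => ⟪l i, Dg i z⟫ * ρ z) μ :=
      hρ.bdd_mul (c := ‖l i‖ * C') (by fun_prop) (Eventually.of_forall fun z =>
        (norm_inner_le_norm _ _).trans (by gcongr; exact hC' z))
    have h2 : Integrable (fun z => g i z * (⟪k i, z⟫ * ρ z)) μ :=
      (hkρ i).bdd_mul (hg i).continuous.aestronglyMeasurable (Eventually.of_forall hC)
    refine (h1.neg.add h2).congr (Eventually.of_forall fun z => ?_)
    simp only [Pi.add_apply, Pi.neg_apply]
    ring
  have hR : ∀ i, Integrable (fun z => g i z * ⟪l i, Φ z⟫) μ := fun i => by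
    obtain ⟨C, hC⟩ := (hg i).exists_bound
    exact (hΦ.const_inner (l i)).bdd_mul (hg i).continuous.aestronglyMeasurable
      (Eventually.of_forall hC)
  have hD : ∀ z, Dstar b α g Dg l z * ρ z
      = ∑ i, (-⟪l i, Dg i z⟫ + g i z * ⟪k i, z⟫) * ρ z := fun z => by
    rw [Dstar, Finset.sum_mul]
    refine Finset.sum_congr rfl fun i _ => ?_
    rw [hk, real_inner_smul_left]
    ring
  have hG : ∀ z, ⟪∑ i, g i z • l i, Φ z⟫ = ∑ i, g i z * ⟪l i, Φ z⟫ := fun z => by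
    simp only [sum_inner, real_inner_smul_left]
  simp_rw [hD, hG]
  rw [integral_finsetSum _ fun i _ => hL i, integral_finsetSum _ fun i _ => hR i]
  exact Finset.sum_congr rfl fun i _ => integral_parts
    (fun u Du hu => integral_inner_gradient_eq_of_memDA b hδ hα hGauss (hl i) hu)
    hρ hΦ hCb hL1 hL1D (hkρ i) (hg i)

end Operators

lemma inner_ite_inv_norm_smul_mul_norm {E : Type*} [NormedAddCommGroup E] [InnerProductSpace ℝ E]
    (x y : E) [Decidable (y = 0)] : ⟪x, if y = 0 then 0 else ‖y‖⁻¹ • y⟫ * ‖y‖ = ⟪x, y⟫ := by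
  split_ifs with hy
  · simp [hy]
  · rw [real_inner_smul_right, mul_right_comm, inv_mul_cancel₀ (norm_ne_zero_iff.2 hy), one_mul]

open Classical

/-- Theorem 3.1(iv). If `ρ ∈ W^{1,1}(H)` (i.e. `ρ ∈ L¹(H,μ)` and there are
`ρ_n ∈ C_b¹(H)` with `ρ_n → ρ` in `L¹(H,μ)` and `Dρ_n → Φ =: Dρ` in `L¹(H,μ;H)`) and
`∫ A_{1/2}(|ρ|) dμ < ∞`, then `ρ ∈ BV(H,H)` with `V(ρ) = ∫ |Dρ| dμ`, and for every
`G ∈ (C_b¹)_{D(A)}`: `∫ D*G ρ dμ = ∫ ⟨G(z), σ(z)⟩ |Dρ(z)| μ(dz)` where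
`σ = Dρ/|Dρ|` on `{Dρ ≠ 0}` and `σ = 0` elsewhere. -/
theorem W11_subset_BV
    {H : Type*} [NormedAddCommGroup H] [InnerProductSpace ℝ H] [CompleteSpace H]
    [SecondCountableTopology H] [MeasurableSpace H] [BorelSpace H]
    (e : ℕ → H) (hON : Orthonormal ℝ e)
    (hTot : (Submodule.span ℝ (Set.range e)).topologicalClosure = ⊤)
    (α : ℕ → ℝ) (δ : ℝ) (hδ : 0 < δ) (hαδ : ∀ j, δ ≤ α j)
    (hαsum : Summable fun j => (α j)⁻¹)
    (μ : Measure H) [IsProbabilityMeasure μ]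
    (hGauss : ∀ h : H, μ.map (fun x => ⟪x, h⟫)
      = ProbabilityTheory.gaussianReal 0 (Real.toNNReal ⟪Qop e α h, h⟫))
    (ρ : H → ℝ) (hρmeas : Measurable ρ) (hρint : Integrable ρ μ)
    (Φ : H → H) (hΦmeas : Measurable Φ) (hΦint : Integrable Φ μ)
    (ρn : ℕ → H → ℝ) (Dρn : ℕ → H → H) (hCb : ∀ k, IsCb1 (ρn k) (Dρn k))
    (hL1 : Tendsto (fun k => ∫ z, |ρn k z - ρ z| ∂μ) atTop (nhds 0))
    (hL1D : Tendsto (fun k => ∫ z, ‖Dρn k z - Φ z‖ ∂μ) atTop (nhds 0))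
    (hρA12 : Integrable (fun z => A12 |ρ z|) μ) :
    BddAbove (BVsetH e α μ ρ) ∧
    sSup (BVsetH e α μ ρ) = ∫ z, ‖Φ z‖ ∂μ ∧
    ∀ (k : ℕ) (g : Fin k → H → ℝ) (Dg : Fin k → H → H) (l : Fin k → H),
      (∀ i, IsCb1 (g i) (Dg i)) → (∀ i, memDA e α (l i)) →
      ∫ z, Dstar e α g Dg l z * ρ z ∂μ
        = ∫ z, ⟪∑ i, g i z • l i, if Φ z = 0 then 0 else ‖Φ z‖⁻¹ • Φ z⟫ * ‖Φ z‖ ∂μ := by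
  obtain ⟨b, rfl⟩ : ∃ b : HilbertBasis ℕ ℝ H, ⇑b = e :=
    ⟨HilbertBasis.mk hON hTot.ge, HilbertBasis.coe_mk hON hTot.ge⟩
  have hparts : ∀ {m : ℕ} {g : Fin m → H → ℝ} {Dg : Fin m → H → H} {l : Fin m → H},
      (∀ i, IsCb1 (g i) (Dg i)) → (∀ i, memDA b α (l i)) →
      ∫ z, Dstar b α g Dg l z * ρ z ∂μ = ∫ z, ⟪∑ i, g i z • l i, Φ z⟫ ∂μ :=
    fun hg hl => integral_Dstar_mul_eq b hδ hαδ hGauss hρint hΦint hCb hL1 hL1D hρA12 hg hl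
  have hlub : IsLUB (BVsetH b α μ ρ) (∫ z, ‖Φ z‖ ∂μ) := by
    refine ⟨?_, fun B hB => le_of_forall_pos_sub_le fun ε hε => ?_⟩
    · rintro r ⟨m, g, Dg, l, hg, hl, hG, rfl⟩
      rw [hparts hg hl]
      refine (Real.le_norm_self _).trans (norm_integral_le_of_norm_le hΦint.norm
        (Eventually.of_forall fun z => ?_))
      exact (norm_inner_le_norm _ _).trans (mul_le_of_le_one_left (norm_nonneg _) (hG z))
    · obtain ⟨n, hn⟩ := (hL1D.eventually_le_const (show 0 < ε / 5 by positivity)).exists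
      obtain ⟨C, hC⟩ := (hCb n).exists_bound_gradient
      have hmem : MemLp (Dρn n) 2 μ := MemLp.of_bound
        (hCb n).continuous_gradient.aestronglyMeasurable C (Eventually.of_forall hC)
      obtain ⟨m, g, Dg, j, hg, hG, hle⟩ :=
        exists_isCb1_integral_norm_sub_le b hΦint hmem (show 0 < ε / 5 by positivity) hn
      have hl : ∀ i, memDA b α (b (j i)) := fun i => memDA_basis b (j i)
      have := hB ⟨m, g, Dg, fun i => b (j i), hg, hl, hG, rfl⟩
      rw [hparts hg hl] at this
      linarith
  refine ⟨hlub.bddAbove, hlub.csSup_eq ⟨_, 0, Fin.elim0, Fin.elim0, Fin.elim0, fun i => i.elim0,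
    fun i => i.elim0, fun z => by simp, rfl⟩, fun m g Dg l hg hl => ?_⟩
  rw [hparts hg hl]
  simp_rw [inner_ite_inv_norm_smul_mul_norm]
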